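/- Let X be a nonempty set and let Φ be a mapping with domain X². If Φ is combinatorially similar to a pseudometric, then there is a Ptolemaic pseudometric d on X such that Φ is combinatorially similar to d. -/

import Mathlib

open Set

universe u v w z

def range2 {X : Type u} {A : Type w} (Φ : X → X → A) : Set A := {a | ∃ x y, Φ x y = a}

def fiber {X : Type u} {A : Type w} (Φ : X → X → A) (a : A) : Set (X × X) :=
  {p | Φ p.1 p.2 = a}

def fibers {X : Type u} {A : Type w} (Φ : X → X → A) : Set (Set (X × X)) :=
  {R | ∃ a ∈ range2 Φ, R = fiber Φ a}

def IsCoherent {X : Type u} {A : Type w} (Φ : X → X → A) (a₀ : A) : Prop :=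
  Equivalence (fun x y => Φ x y = a₀) ∧
    ∀ x₁ x₂ x₃ x₄, Φ x₁ x₂ = a₀ → Φ x₃ x₄ = a₀ → Φ x₁ x₃ = Φ x₂ x₄

def CombSim {X : Type u} {Y : Type v} {A : Type w} {B : Type z}
    (Φ : X → X → A) (Ψ : Y → Y → B) : Prop :=
  ∃ (g : Y → X) (f : A → B), Function.Bijective g ∧
    Set.BijOn f (range2 Φ) (range2 Ψ) ∧ ∀ x y, Ψ x y = f (Φ (g x) (g y))

def IsPseudometric {X : Type u} (d : X → X → ℝ) : Prop :=
  (∀ x y, 0 ≤ d x y) ∧ (∀ x y, d x y = d y x) ∧ (∀ x, d x x = 0) ∧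
    ∀ x y z, d x y ≤ d x z + d z y

def IsPtolemaic {X : Type u} (d : X → X → ℝ) : Prop :=
  ∀ x y zz t, d x y * d zz t ≤ d x zz * d y t + d x t * d y zz

/-- A bounded transform of distances, injective on the nonnegative reals, which fixes `0` and sends
every positive real into `[1, 7 / 5]`. -/
noncomputable def squeezeDist (t : ℝ) : ℝ := if t = 0 then 0 else 1 + 2 / 5 * (t / (1 + t))

theorem squeezeDist_zero : squeezeDist 0 = 0 := if_pos rfl

theorem squeezeDist_mem_Icc {t : ℝ} (ht : 0 < t) : squeezeDist t ∈ Icc (1 : ℝ) (7 / 5) := by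
  have h0 : 0 ≤ t / (1 + t) := by positivity
  have h1 : t / (1 + t) ≤ 1 := (div_le_one (by linarith)).2 (by linarith)
  rw [squeezeDist, if_neg ht.ne']
  constructor <;> linarith

theorem squeezeDist_nonneg {t : ℝ} (ht : 0 ≤ t) : 0 ≤ squeezeDist t := by
  rcases ht.eq_or_lt with rfl | ht
  · exact squeezeDist_zero.ge
  · exact zero_le_one.trans (squeezeDist_mem_Icc ht).1

theorem squeezeDist_injOn : InjOn squeezeDist (Ici 0) := by
  intro s hs t ht h
  rcases (mem_Ici.1 hs).eq_or_lt with rfl | hs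
  · rcases (mem_Ici.1 ht).eq_or_lt with rfl | ht
    · rfl
    · linarith [(squeezeDist_mem_Icc ht).1, squeezeDist_zero]
  · rcases (mem_Ici.1 ht).eq_or_lt with rfl | ht
    · linarith [(squeezeDist_mem_Icc hs).1, squeezeDist_zero]
    · rw [squeezeDist, squeezeDist, if_neg hs.ne', if_neg ht.ne'] at h
      have h' : s / (1 + s) = t / (1 + t) := by linarith
      rw [div_eq_div_iff (by linarith) (by linarith)] at h'
      linarith

theorem IsPseudometric.congr_left {X : Type u} {d : X → X → ℝ} (hd : IsPseudometric d) {x z : X}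
    (h : d x z = 0) (y : X) : d x y = d z y := by
  obtain ⟨-, hsymm, -, htri⟩ := hd
  linarith [htri x y z, htri z y x, hsymm x z]

theorem IsPseudometric.comp_squeezeDist {X : Type u} {d : X → X → ℝ} (hd : IsPseudometric d) :
    IsPseudometric fun x y => squeezeDist (d x y) := by
  have hsymm := hd.2.1
  refine ⟨fun x y => squeezeDist_nonneg (hd.1 x y), fun x y => by simp only [hsymm x y],
    fun x => by simp only [hd.2.2.1, squeezeDist_zero], fun x y z => ?_⟩
  change squeezeDist (d x y) ≤ squeezeDist (d x z) + squeezeDist (d z y)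
  rcases (hd.1 x z).eq_or_lt with h | hxz
  · rw [hd.congr_left h.symm, ← h, squeezeDist_zero, zero_add]
  rcases (hd.1 z y).eq_or_lt with h | hzy
  · rw [hsymm x y, hd.congr_left ((hsymm y z).trans h.symm), ← h, squeezeDist_zero, add_zero, hsymm]
  rcases (hd.1 x y).eq_or_lt with h | hxy
  · rw [← h, squeezeDist_zero]
    exact add_nonneg (squeezeDist_nonneg hxz.le) (squeezeDist_nonneg hzy.le)
  linarith [(squeezeDist_mem_Icc hxz).1, (squeezeDist_mem_Icc hzy).1, (squeezeDist_mem_Icc hxy).2]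

/-- A pseudometric whose nonzero values lie in `[1, 7 / 5]` is Ptolemaic, since
`(7 / 5) ^ 2 ≤ 2`. -/
theorem IsPseudometric.isPtolemaic {X : Type u} {d : X → X → ℝ} (hd : IsPseudometric d)
    (hval : ∀ x y, d x y = 0 ∨ d x y ∈ Icc (1 : ℝ) (7 / 5)) : IsPtolemaic d := by
  intro x y z t
  have hnn := hd.1
  have hsymm := hd.2.1
  have hmul (a b a' b' : X) : 0 ≤ d a b * d a' b' := mul_nonneg (hnn a b) (hnn a' b')
  rcases hval x z with h | hxz
  · rw [hd.congr_left h y, hd.congr_left h t, hsymm y z]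
    linarith [hmul x z y t, mul_comm (d z y) (d z t)]
  rcases hval y t with h | hyt
  · rw [hsymm x y, hd.congr_left h x, hd.congr_left h z, hsymm t x, hsymm t z]
    linarith [hmul x z y t]
  rcases hval x t with h | hxt
  · rw [hd.congr_left h y, hd.congr_left h z, hsymm y t, hsymm t z]
    linarith [hmul x t y z, mul_comm (d t y) (d z t)]
  rcases hval y z with h | hyz
  · rw [hsymm x y, hd.congr_left h x, hd.congr_left h t, hsymm z x]
    linarith [hmul x t y z]
  have hle (a b : X) : d a b ≤ 7 / 5 := by
    rcases hval a b with h | h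
    · rw [h]; norm_num
    · exact h.2
  have hlhs : d x y * d z t ≤ 7 / 5 * (7 / 5) :=
    mul_le_mul (hle x y) (hle z t) (hnn z t) (by norm_num)
  linarith [one_le_mul_of_one_le_of_one_le hxz.1 hyt.1,
    one_le_mul_of_one_le_of_one_le hxt.1 hyz.1]

theorem IsPseudometric.of_surjective {X : Type u} {Y : Type v} {d : X → X → ℝ} {g : Y → X}
    (hg : Function.Surjective g) (hd : IsPseudometric fun x y => d (g x) (g y)) :
    IsPseudometric d := by
  obtain ⟨hnn, hsymm, hself, htri⟩ := hd
  exact ⟨hg.forall₂.2 hnn, hg.forall₂.2 hsymm, hg.forall.2 hself, hg.forall₃.2 htri⟩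

theorem combSim_comp {X : Type u} {A : Type w} {B : Type z} {Φ : X → X → A} {f : A → B}
    (hf : InjOn f (range2 Φ)) : CombSim Φ fun x y => f (Φ x y) := by
  refine ⟨id, f, Function.bijective_id, ⟨?_, hf, ?_⟩, fun _ _ => rfl⟩
  · rintro _ ⟨x, y, rfl⟩
    exact ⟨x, y, rfl⟩
  · rintro _ ⟨x, y, rfl⟩
    exact ⟨Φ x y, ⟨x, y, rfl⟩, rfl⟩

/-- Corollary 3.2: if `Φ` (with domain `X²`) is combinatorially similar to a
pseudometric, then `Φ` is combinatorially similar to a Ptolemaic pseudometric `d` on `X`. -/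
theorem combSim_ptolemaic_of_combSim_pseudometric {X : Type u} {A : Type w} [Nonempty X]
    (Φ : X → X → A)
    (h : ∃ (Y : Type v) (d : Y → Y → ℝ), IsPseudometric d ∧ CombSim Φ d) :
    ∃ d : X → X → ℝ, IsPseudometric d ∧ IsPtolemaic d ∧ CombSim Φ d := by
  obtain ⟨Y, d, hd, g, f, hg, hf, hdf⟩ := h
  obtain rfl : d = fun x y => f (Φ (g x) (g y)) := funext₂ hdf
  have hpm : IsPseudometric fun x y => f (Φ x y) := .of_surjective hg.2 hd
  refine ⟨fun x y => squeezeDist (f (Φ x y)), hpm.comp_squeezeDist,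
    hpm.comp_squeezeDist.isPtolemaic fun x y => ?_,
    combSim_comp (f := squeezeDist ∘ f) (squeezeDist_injOn.comp hf.injOn ?_)⟩
  · rcases (hpm.1 x y).eq_or_lt with h | h
    · exact .inl ((congrArg squeezeDist h.symm).trans squeezeDist_zero)
    · exact .inr (squeezeDist_mem_Icc h)
  · rintro _ ⟨x, y, rfl⟩
    exact hpm.1 x y
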